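/- arXiv:1707.03033 — 2 statements merged into one kernel-verified Lean document; each statement's English description precedes it below -/
import Mathlib

section
/- Let A and H be cocommutative Hopf algebras over a field k and let (H, ◁) be a right A-module bialgebra. Consider the cocommutative Hopf brace on the tensor product coalgebra A ⊗ H with multiplications (a ⊗ x)(b ⊗ y) = ab₍₁₎ ⊗ (x ◁ b₍₂₎)y and (a ⊗ x) ∘ (b ⊗ y) = ab ⊗ yx, with antipodes S (first structure) and T (second structure). Then the linear map c defined by c((a ⊗ x) ⊗ (b ⊗ y)) = (b₍₁₎ ⊗ S(x₍₁₎ ◁ b₍₂₎)·y·x₍₂₎) ⊗ (T(b₍₃₎)·a·b₍₅₎ ⊗ T(S(x₍₃₎) ◁ b₍₄₎)), where S and T here denote the corresponding antipodes acting componentwise, is a solution of the braid equation. -/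
/-! Common definitions for formalizing "Constructing Hopf braces" (Agore). -/

open TensorProduct LinearMap

namespace HopfBraceNL

universe u

variable (k : Type u) [Field k]

section HopfStr

variable (V : Type u) [AddCommGroup V] [Module k V] [Coalgebra k V]

/-- The coalgebra `V` is cocommutative. -/
def IsCocomm : Prop :=
  (TensorProduct.comm k V V).toLinearMap ∘ₗ (Coalgebra.comul (R := k) (A := V)) =
    Coalgebra.comul (R := k) (A := V)

/-- A Hopf algebra structure on the underlying coalgebra of `V`: a multiplication, unit and
antipode making `V` a Hopf algebra whose comultiplication and counit are the given ones. -/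
structure HopfStr where
  mul : V ⊗[k] V →ₗ[k] V
  one : V
  mul_assoc : ∀ a b c : V, mul (mul (a ⊗ₜ[k] b) ⊗ₜ[k] c) = mul (a ⊗ₜ[k] mul (b ⊗ₜ[k] c))
  one_mul : ∀ a : V, mul (one ⊗ₜ[k] a) = a
  mul_one : ∀ a : V, mul (a ⊗ₜ[k] one) = a
  comul_mul : ∀ a b : V,
    Coalgebra.comul (R := k) (mul (a ⊗ₜ[k] b)) =
      TensorProduct.map mul mul
        (TensorProduct.tensorTensorTensorComm k V V V V
          (Coalgebra.comul (R := k) a ⊗ₜ[k] Coalgebra.comul (R := k) b))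
  counit_mul : ∀ a b : V,
    Coalgebra.counit (R := k) (mul (a ⊗ₜ[k] b)) =
      Coalgebra.counit (R := k) a * Coalgebra.counit (R := k) b
  comul_one : Coalgebra.comul (R := k) one = one ⊗ₜ[k] one
  counit_one : Coalgebra.counit (R := k) one = 1
  antipode : V →ₗ[k] V
  antipode_left :
    mul ∘ₗ rTensor V antipode ∘ₗ Coalgebra.comul =
      toSpanSingleton k V one ∘ₗ Coalgebra.counit
  antipode_right :
    mul ∘ₗ lTensor V antipode ∘ₗ Coalgebra.comul =
      toSpanSingleton k V one ∘ₗ Coalgebra.counit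

variable {k V}

/-- The Hopf structure is commutative. -/
def HopfStr.IsComm (hs : HopfStr k V) : Prop :=
  ∀ x y : V, hs.mul (x ⊗ₜ[k] y) = hs.mul (y ⊗ₜ[k] x)

/-- The linear map `x ⊗ y ⊗ z ↦ (x₍₁₎ ∘ y)·S(x₍₂₎)·(x₍₃₎ ∘ z)` (Sweedler notation), the right
hand side of the Hopf brace compatibility condition, written point-free.  Here `m` and `S` are
the multiplication and antipode of the first Hopf structure and `m'` the multiplication of the
second one. -/
noncomputable def braceRHS (m : V ⊗[k] V →ₗ[k] V) (S : V →ₗ[k] V)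
    (m' : V ⊗[k] V →ₗ[k] V) : V ⊗[k] (V ⊗[k] V) →ₗ[k] V :=
  m ∘ₗ lTensor V m
    ∘ₗ TensorProduct.map m' (TensorProduct.map S m')
    ∘ₗ lTensor (V ⊗[k] V) (TensorProduct.assoc k V V V).toLinearMap
    ∘ₗ (TensorProduct.tensorTensorTensorComm k V (V ⊗[k] V) V V).toLinearMap
    ∘ₗ rTensor (V ⊗[k] V)
        ((lTensor V (Coalgebra.comul (R := k))) ∘ₗ (Coalgebra.comul (R := k) (A := V)))

variable (k V) in
/-- A Hopf brace on the coalgebra `V`: two Hopf algebra structures subject to the compatibility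
`x ∘ (y·z) = (x₍₁₎ ∘ y)·S(x₍₂₎)·(x₍₃₎ ∘ z)`. -/
structure HopfBrace where
  dot : HopfStr k V
  circ : HopfStr k V
  brace : circ.mul ∘ₗ lTensor V dot.mul = braceRHS dot.mul dot.antipode circ.mul

/-- A solution of the braid equation on `V ⊗ V`. -/
def SolvesBraid {W : Type u} [AddCommGroup W] [Module k W]
    (c : W ⊗[k] W →ₗ[k] W ⊗[k] W) : Prop :=
  letI c₁ : (W ⊗[k] W) ⊗[k] W →ₗ[k] (W ⊗[k] W) ⊗[k] W := rTensor W c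
  letI c₂ : (W ⊗[k] W) ⊗[k] W →ₗ[k] (W ⊗[k] W) ⊗[k] W :=
    (TensorProduct.assoc k W W W).symm.toLinearMap ∘ₗ lTensor W c ∘ₗ
      (TensorProduct.assoc k W W W).toLinearMap
  c₁ ∘ₗ c₂ ∘ₗ c₁ = c₂ ∘ₗ c₁ ∘ₗ c₂

end HopfStr

section Actions

variable {k}
variable {A H : Type u}
  [AddCommGroup A] [Module k A] [Coalgebra k A]
  [AddCommGroup H] [Module k H] [Coalgebra k H]

/-- `(x, a) ↦ (x₍₁₎ ⊗ a₍₁₎) ⊗ (x₍₂₎ ⊗ a₍₂₎)`, as an element. -/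
noncomputable def split (x : H) (a : A) : (H ⊗[k] A) ⊗[k] (H ⊗[k] A) :=
  TensorProduct.tensorTensorTensorComm k H H A A
    (Coalgebra.comul (R := k) x ⊗ₜ[k] Coalgebra.comul (R := k) a)

/-- `A` is a left module over the Hopf structure `hH` via `act`. -/
structure IsLeftModule (hH : HopfStr k H) (act : H ⊗[k] A →ₗ[k] A) : Prop where
  one_act : ∀ a : A, act (hH.one ⊗ₜ[k] a) = a
  mul_act : ∀ (x y : H) (a : A),
    act (hH.mul (x ⊗ₜ[k] y) ⊗ₜ[k] a) = act (x ⊗ₜ[k] act (y ⊗ₜ[k] a))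

/-- `A` is a left module over `hH`-op via `act`, i.e. `(xy) ▶ a = y ▶ (x ▶ a)`. -/
structure IsLeftOpModule (hH : HopfStr k H) (act : H ⊗[k] A →ₗ[k] A) : Prop where
  one_act : ∀ a : A, act (hH.one ⊗ₜ[k] a) = a
  mul_act : ∀ (x y : H) (a : A),
    act (hH.mul (x ⊗ₜ[k] y) ⊗ₜ[k] a) = act (y ⊗ₜ[k] act (x ⊗ₜ[k] a))

/-- The measuring conditions: `x ▶ (ab) = (x₍₁₎ ▶ a)(x₍₂₎ ▶ b)` and `x ▶ 1 = ε(x)1`. -/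
structure IsModuleAlgebraLaw (hA : HopfStr k A) (act : H ⊗[k] A →ₗ[k] A) : Prop where
  act_mul : ∀ (x : H) (a b : A),
    act (x ⊗ₜ[k] hA.mul (a ⊗ₜ[k] b)) =
      hA.mul (TensorProduct.map act act
        (TensorProduct.tensorTensorTensorComm k H H A A
          (Coalgebra.comul (R := k) x ⊗ₜ[k] (a ⊗ₜ[k] b))))
  act_one : ∀ x : H, act (x ⊗ₜ[k] hA.one) = Coalgebra.counit (R := k) x • hA.one

/-- `act` is a coalgebra map: `Δ(x ▶ a) = (x₍₁₎ ▶ a₍₁₎) ⊗ (x₍₂₎ ▶ a₍₂₎)`,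
`ε(x ▶ a) = ε(x)ε(a)`. -/
structure IsCoalgebraLaw (act : H ⊗[k] A →ₗ[k] A) : Prop where
  comul_act : ∀ (x : H) (a : A),
    Coalgebra.comul (R := k) (act (x ⊗ₜ[k] a)) = TensorProduct.map act act (split x a)
  counit_act : ∀ (x : H) (a : A),
    Coalgebra.counit (R := k) (act (x ⊗ₜ[k] a)) =
      Coalgebra.counit (R := k) x * Coalgebra.counit (R := k) a

/-- `(A, act)` is a left `hH`-module algebra. -/
structure IsLeftModuleAlgebra (hH : HopfStr k H) (hA : HopfStr k A)
    (act : H ⊗[k] A →ₗ[k] A) : Prop where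
  toIsLeftModule : IsLeftModule hH act
  toLaw : IsModuleAlgebraLaw hA act

/-- `(A, act)` is a left `hH`-module coalgebra. -/
structure IsLeftModuleCoalgebra (hH : HopfStr k H) (act : H ⊗[k] A →ₗ[k] A) : Prop where
  toIsLeftModule : IsLeftModule hH act
  toCoalgLaw : IsCoalgebraLaw act

/-- `(A, act)` is a left `hH`-module bialgebra. -/
structure IsLeftModuleBialgebra (hH : HopfStr k H) (hA : HopfStr k A)
    (act : H ⊗[k] A →ₗ[k] A) : Prop where
  toIsLeftModule : IsLeftModule hH act
  toLaw : IsModuleAlgebraLaw hA act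
  toCoalgLaw : IsCoalgebraLaw act

/-- `(A, act)` is a left `hH`-op-module bialgebra. -/
structure IsLeftOpModuleBialgebra (hH : HopfStr k H) (hA : HopfStr k A)
    (act : H ⊗[k] A →ₗ[k] A) : Prop where
  toIsLeftOpModule : IsLeftOpModule hH act
  toLaw : IsModuleAlgebraLaw hA act
  toCoalgLaw : IsCoalgebraLaw act

/-- `H` is a right module over the Hopf structure `hA` via `ract : H ⊗ A → H`. -/
structure IsRightModule (hA : HopfStr k A) (ract : H ⊗[k] A →ₗ[k] H) : Prop where
  act_one : ∀ x : H, ract (x ⊗ₜ[k] hA.one) = x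
  act_mul : ∀ (x : H) (a b : A),
    ract (x ⊗ₜ[k] hA.mul (a ⊗ₜ[k] b)) = ract (ract (x ⊗ₜ[k] a) ⊗ₜ[k] b)

/-- `ract` is a coalgebra map `H ⊗ A → H`. -/
structure IsRightCoalgebraLaw (ract : H ⊗[k] A →ₗ[k] H) : Prop where
  comul_act : ∀ (x : H) (a : A),
    Coalgebra.comul (R := k) (ract (x ⊗ₜ[k] a)) = TensorProduct.map ract ract (split x a)
  counit_act : ∀ (x : H) (a : A),
    Coalgebra.counit (R := k) (ract (x ⊗ₜ[k] a)) =
      Coalgebra.counit (R := k) x * Coalgebra.counit (R := k) a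

/-- `(H, ract)` is a right `hA`-module bialgebra:  in addition to the module and coalgebra
conditions, `(xy) ◁ a = (x ◁ a₍₁₎)(y ◁ a₍₂₎)` and `1 ◁ a = ε(a)1`. -/
structure IsRightModuleBialgebra (hA : HopfStr k A) (hH : HopfStr k H)
    (ract : H ⊗[k] A →ₗ[k] H) : Prop where
  toIsRightModule : IsRightModule hA ract
  mul_ract : ∀ (x y : H) (a : A),
    ract (hH.mul (x ⊗ₜ[k] y) ⊗ₜ[k] a) =
      hH.mul (TensorProduct.map ract ract
        (TensorProduct.tensorTensorTensorComm k H H A A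
          ((x ⊗ₜ[k] y) ⊗ₜ[k] Coalgebra.comul (R := k) a)))
  one_ract : ∀ a : A, ract (hH.one ⊗ₜ[k] a) = Coalgebra.counit (R := k) a • hH.one
  toCoalgLaw : IsRightCoalgebraLaw ract

/-- `(A, H, tri, quad)` is a matched pair of Hopf algebras. -/
structure IsMatchedPair (hA : HopfStr k A) (hH : HopfStr k H)
    (tri : H ⊗[k] A →ₗ[k] A) (quad : H ⊗[k] A →ₗ[k] H) : Prop where
  tri_module : IsLeftModule hH tri
  tri_coalg : IsCoalgebraLaw tri
  quad_module : IsRightModule hA quad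
  quad_coalg : IsRightCoalgebraLaw quad
  mp1 : ∀ x : H, tri (x ⊗ₜ[k] hA.one) = Coalgebra.counit (R := k) x • hA.one
  mp1' : ∀ a : A, quad (hH.one ⊗ₜ[k] a) = Coalgebra.counit (R := k) a • hH.one
  mp2 : ∀ (x : H) (a b : A),
    tri (x ⊗ₜ[k] hA.mul (a ⊗ₜ[k] b)) =
      hA.mul (lTensor A tri (TensorProduct.assoc k A H A
        ((TensorProduct.map tri quad (split x a)) ⊗ₜ[k] b)))
  mp3 : ∀ (x y : H) (a : A),
    quad (hH.mul (x ⊗ₜ[k] y) ⊗ₜ[k] a) =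
      hH.mul (rTensor H quad ((TensorProduct.assoc k H A H).symm
        (x ⊗ₜ[k] TensorProduct.map tri quad (split y a))))
  mp4 : ∀ (x : H) (a : A),
    TensorProduct.map quad tri (split x a) =
      TensorProduct.comm k A H (TensorProduct.map tri quad (split x a))

variable (k) in
/-- `(a ⊗ (u₁ ⊗ u₂)) ⊗ y ↦ mA (a ⊗ u₁) ⊗ mH (u₂ ⊗ y)`: the standard way to assemble
a multiplication on `A ⊗ H` from a middle term `u ∈ A ⊗ H`. -/
noncomputable def sandwich (mA : A ⊗[k] A →ₗ[k] A) (mH : H ⊗[k] H →ₗ[k] H) :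
    (A ⊗[k] (A ⊗[k] H)) ⊗[k] H →ₗ[k] A ⊗[k] H :=
  TensorProduct.map mA mH
    ∘ₗ (TensorProduct.assoc k (A ⊗[k] A) H H).toLinearMap
    ∘ₗ rTensor H (TensorProduct.assoc k A A H).symm.toLinearMap

variable (k) in
/-- `(m ⊗ n) ⊗ p ↦ (m ⊗ p) ⊗ n`. -/
noncomputable def rightComm (M N P : Type u) [AddCommGroup M] [Module k M]
    [AddCommGroup N] [Module k N] [AddCommGroup P] [Module k P] :
    (M ⊗[k] N) ⊗[k] P →ₗ[k] (M ⊗[k] P) ⊗[k] N :=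
  (TensorProduct.assoc k M P N).symm.toLinearMap
    ∘ₗ lTensor M (TensorProduct.comm k N P).toLinearMap
    ∘ₗ (TensorProduct.assoc k M N P).toLinearMap

/-- `(x, b) ↦ (x₍₁₎ ▷ b₍₁₎) ⊗ (x₍₂₎ ◁ b₍₂₎)`. -/
noncomputable def matchedEl (tri : H ⊗[k] A →ₗ[k] A) (quad : H ⊗[k] A →ₗ[k] H)
    (x : H) (b : A) : A ⊗[k] H :=
  TensorProduct.map tri quad (split x b)

/-- `(x, b) ↦ (x₍₁₎ ▷ b) ⊗ x₍₂₎`. -/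
noncomputable def smashEl (tri : H ⊗[k] A →ₗ[k] A) (x : H) (b : A) : A ⊗[k] H :=
  rTensor H tri (rightComm k H H A (Coalgebra.comul (R := k) x ⊗ₜ[k] b))

/-- `(x, b) ↦ b₍₁₎ ⊗ (x ◁ b₍₂₎)`. -/
noncomputable def rsmashEl (ract : H ⊗[k] A →ₗ[k] H) (x : H) (b : A) : A ⊗[k] H :=
  lTensor A ract (TensorProduct.leftComm k H A A (x ⊗ₜ[k] Coalgebra.comul (R := k) b))

end Actions


section Pairing

open Coalgebra

variable {k}
variable {C D U V W X R : Type u}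
  [AddCommMonoid C] [Module k C] [Coalgebra k C] [AddCommMonoid D] [Module k D] [Coalgebra k D]
  [AddCommMonoid U] [Module k U] [AddCommMonoid V] [Module k V]
  [AddCommMonoid W] [Module k W] [AddCommMonoid X] [Module k X] [AddCommMonoid R] [Module k R]

/-- The pairing `e ↦ f e₍₁₎ ⊗ g e₍₂₎` of two linear maps out of a coalgebra. -/
noncomputable def pair (f : C →ₗ[k] V) (g : C →ₗ[k] W) : C →ₗ[k] V ⊗[k] W :=
  TensorProduct.map f g ∘ₗ comul

theorem map_comp_pair (f : U →ₗ[k] V) (g : W →ₗ[k] X) (p : C →ₗ[k] U) (q : C →ₗ[k] W) :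
    TensorProduct.map f g ∘ₗ pair p q = pair (f ∘ₗ p) (g ∘ₗ q) := by
  simp only [pair, TensorProduct.map_comp, LinearMap.comp_assoc]

theorem lTensor_comp_pair (g : W →ₗ[k] X) (p : C →ₗ[k] U) (q : C →ₗ[k] W) :
    lTensor U g ∘ₗ pair p q = pair p (g ∘ₗ q) :=
  map_comp_pair LinearMap.id g p q

theorem rTensor_comp_pair (f : U →ₗ[k] V) (p : C →ₗ[k] U) (q : C →ₗ[k] W) :
    rTensor W f ∘ₗ pair p q = pair (f ∘ₗ p) q :=
  map_comp_pair f LinearMap.id p q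

theorem pair_comp_coalgHom (f : C →ₗ[k] V) (g : C →ₗ[k] W) (h : D →ₗc[k] C) :
    pair f g ∘ₗ (h : D →ₗ[k] C) = pair (f ∘ₗ (h : D →ₗ[k] C)) (g ∘ₗ (h : D →ₗ[k] C)) := by
  simp only [pair, TensorProduct.map_comp, LinearMap.comp_assoc]
  rw [CoalgHomClass.map_comp_comul]

theorem comul_comp_coalgHom (h : D →ₗc[k] C) :
    comul ∘ₗ (h : D →ₗ[k] C) = pair (h : D →ₗ[k] C) (h : D →ₗ[k] C) :=
  (CoalgHomClass.map_comp_comul h).symm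

theorem assoc_comp_pair (f : C →ₗ[k] U) (g : C →ₗ[k] V) (h : C →ₗ[k] W) :
    (TensorProduct.assoc k U V W).toLinearMap ∘ₗ pair (pair f g) h = pair f (pair g h) := by
  have h1 : pair (pair f g) h =
      TensorProduct.map (TensorProduct.map f g) h ∘ₗ rTensor C comul ∘ₗ comul := by
    rw [← LinearMap.comp_assoc, LinearMap.map_comp_rTensor]; rfl
  have h2 : pair f (pair g h) =
      TensorProduct.map f (TensorProduct.map g h) ∘ₗ lTensor C comul ∘ₗ comul := by
    rw [← LinearMap.comp_assoc, LinearMap.map_comp_lTensor]; rfl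
  have e : (TensorProduct.assoc k U V W).toLinearMap ∘ₗ
      TensorProduct.map (TensorProduct.map f g) h =
        TensorProduct.map f (TensorProduct.map g h) ∘ₗ
          (TensorProduct.assoc k C C C).toLinearMap := by
    ext; simp
  rw [h1, h2, ← Coalgebra.coassoc, ← LinearMap.comp_assoc, e, LinearMap.comp_assoc]

theorem assoc_symm_comp_pair (f : C →ₗ[k] U) (g : C →ₗ[k] V) (h : C →ₗ[k] W) :
    (TensorProduct.assoc k U V W).symm.toLinearMap ∘ₗ pair f (pair g h) = pair (pair f g) h := by
  rw [← assoc_comp_pair, ← LinearMap.comp_assoc]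
  simp

variable [Coalgebra.IsCocomm k C]

theorem comm_comp_pair (f : C →ₗ[k] U) (g : C →ₗ[k] V) :
    (TensorProduct.comm k U V).toLinearMap ∘ₗ pair f g = pair g f := by
  have h : pair g f = TensorProduct.map g f ∘ₗ
      (TensorProduct.comm k C C).toLinearMap ∘ₗ comul := by
    rw [Coalgebra.comm_comp_comul]; rfl
  rw [h, pair, ← LinearMap.comp_assoc, ← LinearMap.comp_assoc]
  congr 1
  ext; simp

theorem leftComm_comp_pair (f : C →ₗ[k] U) (g : C →ₗ[k] V) (h : C →ₗ[k] W) :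
    (TensorProduct.leftComm k U V W).toLinearMap ∘ₗ pair f (pair g h) = pair g (pair f h) := by
  have e : (TensorProduct.leftComm k U V W).toLinearMap =
      (TensorProduct.assoc k V U W).toLinearMap ∘ₗ
        rTensor W (TensorProduct.comm k U V).toLinearMap ∘ₗ
          (TensorProduct.assoc k U V W).symm.toLinearMap := by
    ext; simp
  rw [e, LinearMap.comp_assoc, LinearMap.comp_assoc, assoc_symm_comp_pair, rTensor_comp_pair,
    comm_comp_pair, assoc_comp_pair]

theorem tensorTensorTensorComm_comp_pair (f : C →ₗ[k] U) (g : C →ₗ[k] V) (h : C →ₗ[k] W)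
    (l : C →ₗ[k] X) :
    (TensorProduct.tensorTensorTensorComm k U V W X).toLinearMap ∘ₗ pair (pair f g) (pair h l) =
      pair (pair f h) (pair g l) := by
  have e : (TensorProduct.tensorTensorTensorComm k U V W X).toLinearMap =
      (TensorProduct.assoc k U W (V ⊗[k] X)).symm.toLinearMap ∘ₗ
        lTensor U (TensorProduct.leftComm k V W X).toLinearMap ∘ₗ
          (TensorProduct.assoc k U V (W ⊗[k] X)).toLinearMap := by
    ext; simp
  rw [e, LinearMap.comp_assoc, LinearMap.comp_assoc, assoc_comp_pair, lTensor_comp_pair,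
    leftComm_comp_pair, assoc_symm_comp_pair]

/-- The pairing of two coalgebra morphisms out of a cocommutative coalgebra. -/
noncomputable def pairHom [Coalgebra k V] [Coalgebra k W] (f : C →ₗc[k] V) (g : C →ₗc[k] W) :
    C →ₗc[k] V ⊗[k] W :=
  (Coalgebra.TensorProduct.map f g).comp (comulCoalgHom k C)

end Pairing

section Projections

open Coalgebra

variable {k}
variable {V W : Type u} [AddCommMonoid V] [Module k V] [Coalgebra k V]
  [AddCommMonoid W] [Module k W] [Coalgebra k W]

variable (k V W) in
/-- The coalgebra morphism `v ⊗ w ↦ ε(w) v`. -/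
noncomputable def fstHom : V ⊗[k] W →ₗc[k] V :=
  ((Coalgebra.TensorProduct.rid k k V : V ⊗[k] k ≃ₗc[k] V) : V ⊗[k] k →ₗc[k] V).comp
    (Coalgebra.TensorProduct.map (CoalgHom.id k V) (counitCoalgHom k W))

variable (k V W) in
/-- The coalgebra morphism `v ⊗ w ↦ ε(v) w`. -/
noncomputable def sndHom : V ⊗[k] W →ₗc[k] W :=
  ((Coalgebra.TensorProduct.lid k W : k ⊗[k] W ≃ₗc[k] W) : k ⊗[k] W →ₗc[k] W).comp
    (Coalgebra.TensorProduct.map (counitCoalgHom k V) (CoalgHom.id k W))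

theorem pair_fst_snd :
    pair (fstHom k V W : V ⊗[k] W →ₗ[k] V) (sndHom k V W : V ⊗[k] W →ₗ[k] W) = LinearMap.id := by
  have e : pair (fstHom k V W : V ⊗[k] W →ₗ[k] V) (sndHom k V W : V ⊗[k] W →ₗ[k] W) =
      TensorProduct.map
        ((TensorProduct.rid k V).toLinearMap ∘ₗ lTensor V counit ∘ₗ comul)
        ((TensorProduct.lid k W).toLinearMap ∘ₗ rTensor W counit ∘ₗ comul) := by
    ext v w
    obtain ⟨ι, s, f, g, hv⟩ : ∃ (ι : Type u) (s : Finset ι) (f g : ι → V),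
      ∑ i ∈ s, f i ⊗ₜ[k] g i = comul (R := k) v := ⟨_, _, _, _, (ℛ k v).eq⟩
    obtain ⟨κ, t, f', g', hw⟩ : ∃ (ι : Type u) (s : Finset ι) (f g : ι → W),
      ∑ i ∈ s, f i ⊗ₜ[k] g i = comul (R := k) w := ⟨_, _, _, _, (ℛ k w).eq⟩
    simp [pair, fstHom, sndHom, ← hv, ← hw, tmul_sum, sum_tmul, smul_tmul', tmul_smul,
      Finset.smul_sum, smul_comm (counit (R := k) (g _))]
  rw [e, Coalgebra.lTensor_counit_comp_comul, Coalgebra.rTensor_counit_comp_comul]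
  ext; simp

end Projections

section Points

open Coalgebra

variable {k}
variable {C U V W : Type u}
  [AddCommMonoid C] [Module k C] [Coalgebra k C] [AddCommMonoid U] [Module k U]
  [AddCommGroup V] [Module k V] [AddCommMonoid W] [Module k W]

theorem pair_const_left (v : V) (f : C →ₗ[k] W) :
    pair (toSpanSingleton k V v ∘ₗ counit) f = TensorProduct.mk k V W v ∘ₗ f := by
  have e : TensorProduct.map (toSpanSingleton k V v ∘ₗ counit (R := k) (A := C)) f =
      TensorProduct.map (toSpanSingleton k V v) f ∘ₗ rTensor C (counit (R := k)) := by
    ext; simp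
  rw [pair, e, LinearMap.comp_assoc, Coalgebra.rTensor_counit_comp_comul]
  ext; simp

theorem pair_const_right (f : C →ₗ[k] V) (w : W) :
    pair f (toSpanSingleton k W w ∘ₗ counit) = (TensorProduct.mk k V W).flip w ∘ₗ f := by
  have e : TensorProduct.map f (toSpanSingleton k W w ∘ₗ counit (R := k) (A := C)) =
      TensorProduct.map f (toSpanSingleton k W w) ∘ₗ lTensor C (counit (R := k)) := by
    ext; simp
  rw [pair, e, LinearMap.comp_assoc, Coalgebra.lTensor_counit_comp_comul]
  ext; simp

namespace HopfStr

variable [Coalgebra k V] (hs : HopfStr k V)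

/-- The multiplication of a Hopf structure as a coalgebra morphism. -/
noncomputable def mulHom : V ⊗[k] V →ₗc[k] V where
  toLinearMap := hs.mul
  counit_comp := by
    ext a b
    simp [hs.counit_mul, mul_comm]
  map_comp_comul := by
    ext a b
    exact (hs.comul_mul a b).symm

/-- The unit of a Hopf structure as a coalgebra morphism `e ↦ ε(e) 1`. -/
noncomputable def oneHom (C : Type u) [AddCommMonoid C] [Module k C] [Coalgebra k C] :
    C →ₗc[k] V where
  toLinearMap := toSpanSingleton k V hs.one ∘ₗ counit
  counit_comp := by
    ext a
    simp [hs.counit_one]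
  map_comp_comul := by
    change pair _ _ = _
    rw [pair_const_left]
    ext a
    simp [hs.comul_one]

theorem mul_comp_pair_assoc (f g h : C →ₗ[k] V) :
    hs.mul ∘ₗ pair (hs.mul ∘ₗ pair f g) h = hs.mul ∘ₗ pair f (hs.mul ∘ₗ pair g h) := by
  have e : hs.mul ∘ₗ rTensor V hs.mul =
      hs.mul ∘ₗ lTensor V hs.mul ∘ₗ (TensorProduct.assoc k V V V).toLinearMap := by
    ext a b c
    exact hs.mul_assoc a b c
  rw [← rTensor_comp_pair, ← LinearMap.comp_assoc, e, LinearMap.comp_assoc, LinearMap.comp_assoc,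
    assoc_comp_pair, lTensor_comp_pair]

theorem mul_comp_pair_one_left (f : C →ₗ[k] V) :
    hs.mul ∘ₗ pair (toSpanSingleton k V hs.one ∘ₗ counit) f = f := by
  rw [pair_const_left]
  ext a
  simp [hs.one_mul]

/-- The componentwise multiplication on `V ⊗ V`. -/
noncomputable def mulTensor : (V ⊗[k] V) ⊗[k] (V ⊗[k] V) →ₗ[k] V ⊗[k] V :=
  TensorProduct.map hs.mul hs.mul ∘ₗ
    (TensorProduct.tensorTensorTensorComm k V V V V).toLinearMap

theorem mulTensor_comp_pair_assoc (f g h : C →ₗ[k] V ⊗[k] V) :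
    hs.mulTensor ∘ₗ pair (hs.mulTensor ∘ₗ pair f g) h =
      hs.mulTensor ∘ₗ pair f (hs.mulTensor ∘ₗ pair g h) := by
  have e : hs.mulTensor ∘ₗ rTensor (V ⊗[k] V) hs.mulTensor =
      hs.mulTensor ∘ₗ lTensor (V ⊗[k] V) hs.mulTensor ∘ₗ
        (TensorProduct.assoc k (V ⊗[k] V) (V ⊗[k] V) (V ⊗[k] V)).toLinearMap := by
    ext a b c d e f
    simp [mulTensor, hs.mul_assoc]
  rw [← rTensor_comp_pair, ← LinearMap.comp_assoc, e, LinearMap.comp_assoc, LinearMap.comp_assoc,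
    assoc_comp_pair, lTensor_comp_pair]

theorem mulTensor_comp_pair_one_left (f : C →ₗ[k] V ⊗[k] V) :
    hs.mulTensor ∘ₗ pair (toSpanSingleton k _ (hs.one ⊗ₜ[k] hs.one) ∘ₗ counit) f = f := by
  have e : hs.mulTensor ∘ₗ TensorProduct.mk k _ _ (hs.one ⊗ₜ[k] hs.one) = LinearMap.id := by
    ext; simp [mulTensor, hs.one_mul]
  rw [pair_const_left, ← LinearMap.comp_assoc, e, LinearMap.id_comp]

theorem mulTensor_comp_pair_one_right (f : C →ₗ[k] V ⊗[k] V) :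
    hs.mulTensor ∘ₗ pair f (toSpanSingleton k _ (hs.one ⊗ₜ[k] hs.one) ∘ₗ counit) = f := by
  have e : hs.mulTensor ∘ₗ (TensorProduct.mk k _ _).flip (hs.one ⊗ₜ[k] hs.one) =
      LinearMap.id := by
    ext; simp [mulTensor, hs.mul_one]
  rw [pair_const_right, ← LinearMap.comp_assoc, e, LinearMap.id_comp]

theorem comul_comp_mul :
    comul ∘ₗ hs.mul = hs.mulTensor ∘ₗ TensorProduct.map comul comul := by
  ext a b
  exact hs.comul_mul a b

theorem comul_comp_antipode [Coalgebra.IsCocomm k V] :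
    comul ∘ₗ hs.antipode = pair hs.antipode hs.antipode := by
  have hl : hs.mul ∘ₗ pair hs.antipode LinearMap.id = toSpanSingleton k V hs.one ∘ₗ counit :=
    hs.antipode_left
  have hr : hs.mul ∘ₗ pair LinearMap.id hs.antipode = toSpanSingleton k V hs.one ∘ₗ counit :=
    hs.antipode_right
  have left : hs.mulTensor ∘ₗ pair (comul ∘ₗ hs.antipode) (comul (R := k)) =
      toSpanSingleton k _ (hs.one ⊗ₜ[k] hs.one) ∘ₗ counit := by
    have : pair (comul ∘ₗ hs.antipode) (comul (R := k)) =
        TensorProduct.map comul comul ∘ₗ pair hs.antipode LinearMap.id := by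
      rw [map_comp_pair]; rfl
    rw [this, ← LinearMap.comp_assoc, ← comul_comp_mul, LinearMap.comp_assoc, hl]
    ext; simp [hs.comul_one]
  have right : hs.mulTensor ∘ₗ pair (comul (R := k)) (pair hs.antipode hs.antipode) =
      toSpanSingleton k _ (hs.one ⊗ₜ[k] hs.one) ∘ₗ counit := by
    have : comul (R := k) (A := V) = pair LinearMap.id LinearMap.id := by
      rw [pair, TensorProduct.map_id]; rfl
    rw [this, mulTensor, LinearMap.comp_assoc, tensorTensorTensorComm_comp_pair, map_comp_pair,
      hr, pair_const_left]
    ext; simp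
  rw [← hs.mulTensor_comp_pair_one_right (comul ∘ₗ hs.antipode), ← right,
    ← mulTensor_comp_pair_assoc, left, mulTensor_comp_pair_one_left]

theorem counit_comp_antipode : counit ∘ₗ hs.antipode = counit (R := k) := by
  have h := congrArg (fun f => counit (R := k) ∘ₗ f) hs.antipode_left
  have e : counit (R := k) ∘ₗ hs.mul ∘ₗ rTensor V hs.antipode =
      counit ∘ₗ hs.antipode ∘ₗ (TensorProduct.rid k V).toLinearMap ∘ₗ lTensor V counit := by
    ext; simp [hs.counit_mul, mul_comm]
  have h' : counit (R := k) ∘ₗ hs.mul ∘ₗ rTensor V hs.antipode ∘ₗ comul =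
      (counit (R := k) ∘ₗ hs.mul ∘ₗ rTensor V hs.antipode) ∘ₗ comul := rfl
  simp only [h', e, LinearMap.comp_assoc, Coalgebra.lTensor_counit_comp_comul] at h
  ext a
  simpa [hs.counit_one] using congr($h a)

/-- The antipode of a cocommutative Hopf structure as a coalgebra morphism. -/
noncomputable def antipodeHom [Coalgebra.IsCocomm k V] : V →ₗc[k] V where
  toLinearMap := hs.antipode
  counit_comp := hs.counit_comp_antipode
  map_comp_comul := hs.comul_comp_antipode.symm

/-- The coalgebra morphisms from a cocommutative coalgebra to a cocommutative Hopf algebra form a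
group under convolution. -/
@[reducible]
noncomputable def pointGroup [Coalgebra.IsCocomm k C] [Coalgebra.IsCocomm k V] :
    Group (C →ₗc[k] V) :=
  letI : Mul (C →ₗc[k] V) := ⟨fun f g => hs.mulHom.comp (pairHom f g)⟩
  letI : One (C →ₗc[k] V) := ⟨hs.oneHom C⟩
  letI : Inv (C →ₗc[k] V) := ⟨fun f => hs.antipodeHom.comp f⟩
  Group.ofLeftAxioms
    (fun f g h => CoalgHom.coe_linearMap_injective
      (hs.mul_comp_pair_assoc (f : C →ₗ[k] V) g h))
    (fun f => CoalgHom.coe_linearMap_injective (hs.mul_comp_pair_one_left (f : C →ₗ[k] V)))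
    (fun f => CoalgHom.coe_linearMap_injective <| by
      change hs.mul ∘ₗ pair (hs.antipode ∘ₗ (f : C →ₗ[k] V)) (LinearMap.id ∘ₗ (f : C →ₗ[k] V)) =
        toSpanSingleton k V hs.one ∘ₗ counit
      rw [← pair_comp_coalgHom, ← LinearMap.comp_assoc]
      have h : hs.mul ∘ₗ pair hs.antipode LinearMap.id =
        toSpanSingleton k V hs.one ∘ₗ counit := hs.antipode_left
      rw [h, LinearMap.comp_assoc, CoalgHomClass.counit_comp])

end HopfStr

end Points

section PointAction

open Coalgebra

variable {k}
variable {A H C : Type u}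
  [AddCommGroup A] [Module k A] [Coalgebra k A]
  [AddCommGroup H] [Module k H] [Coalgebra k H]
  [AddCommMonoid C] [Module k C] [Coalgebra k C] [Coalgebra.IsCocomm k C]

/-- A right action that is a coalgebra map, as a coalgebra morphism. -/
noncomputable def IsRightCoalgebraLaw.hom {ract : H ⊗[k] A →ₗ[k] H}
    (h : IsRightCoalgebraLaw ract) : H ⊗[k] A →ₗc[k] H where
  toLinearMap := ract
  counit_comp := by
    ext x a
    simp [h.counit_act, mul_comm]
  map_comp_comul := by
    ext x a
    exact (h.comul_act x a).symm

/-- The action of `A`-valued points on `H`-valued points. -/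
noncomputable def IsRightCoalgebraLaw.pointAct {ract : H ⊗[k] A →ₗ[k] H}
    (h : IsRightCoalgebraLaw ract) (x : C →ₗc[k] H) (a : C →ₗc[k] A) : C →ₗc[k] H :=
  h.hom.comp (pairHom x a)

namespace IsRightModuleBialgebra

variable {hA : HopfStr k A} {hH : HopfStr k H} {ract : H ⊗[k] A →ₗ[k] H}

theorem pointAct_mul [Coalgebra.IsCocomm k A] (hmb : IsRightModuleBialgebra hA hH ract)
    (x : C →ₗc[k] H) (a b : C →ₗc[k] A) :
    letI := hA.pointGroup (C := C)
    hmb.toCoalgLaw.pointAct x (a * b) =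
      hmb.toCoalgLaw.pointAct (hmb.toCoalgLaw.pointAct x a) b := by
  apply CoalgHom.coe_linearMap_injective
  change ract ∘ₗ pair (x : C →ₗ[k] H) (hA.mul ∘ₗ pair (a : C →ₗ[k] A) (b : C →ₗ[k] A)) =
    ract ∘ₗ pair (ract ∘ₗ pair (x : C →ₗ[k] H) (a : C →ₗ[k] A)) (b : C →ₗ[k] A)
  have e : ract ∘ₗ lTensor H hA.mul ∘ₗ (TensorProduct.assoc k H A A).toLinearMap =
      ract ∘ₗ rTensor A ract := by
    ext x a b
    exact hmb.toIsRightModule.act_mul x a b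
  rw [← rTensor_comp_pair, ← LinearMap.comp_assoc, ← e, LinearMap.comp_assoc,
    LinearMap.comp_assoc, assoc_comp_pair, lTensor_comp_pair]

theorem mul_pointAct [Coalgebra.IsCocomm k H] (hmb : IsRightModuleBialgebra hA hH ract)
    (x y : C →ₗc[k] H) (a : C →ₗc[k] A) :
    letI := hH.pointGroup (C := C)
    hmb.toCoalgLaw.pointAct (x * y) a =
      hmb.toCoalgLaw.pointAct x a * hmb.toCoalgLaw.pointAct y a := by
  apply CoalgHom.coe_linearMap_injective
  change ract ∘ₗ pair (hH.mul ∘ₗ pair (x : C →ₗ[k] H) (y : C →ₗ[k] H)) (a : C →ₗ[k] A) =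
    hH.mul ∘ₗ pair (ract ∘ₗ pair (x : C →ₗ[k] H) (a : C →ₗ[k] A))
      (ract ∘ₗ pair (y : C →ₗ[k] H) (a : C →ₗ[k] A))
  have e : ract ∘ₗ rTensor A hH.mul =
      hH.mul ∘ₗ TensorProduct.map ract ract ∘ₗ
        (TensorProduct.tensorTensorTensorComm k H H A A).toLinearMap ∘ₗ
          lTensor (H ⊗[k] H) comul := by
    ext x y a
    exact hmb.mul_ract x y a
  rw [← rTensor_comp_pair, ← LinearMap.comp_assoc, e, LinearMap.comp_assoc,
    LinearMap.comp_assoc, LinearMap.comp_assoc, lTensor_comp_pair, comul_comp_coalgHom,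
    tensorTensorTensorComm_comp_pair, map_comp_pair]

end IsRightModuleBialgebra

end PointAction

/-- The set-theoretic braiding attached to a right action of `G` on `N`. -/
def groupBraiding {G N : Type*} [Group G] [Group N] (act : N → G → N)
    (p : (G × N) × (G × N)) : (G × N) × (G × N) :=
  ((p.2.1, (act p.1.2 p.2.1)⁻¹ * p.2.2 * p.1.2),
    (p.2.1⁻¹ * p.1.1 * p.2.1, (act p.1.2⁻¹ p.2.1)⁻¹))

/-- The map `σ × id` on triples. -/
def braidLeft {P : Type*} (σ : P × P → P × P) (t : (P × P) × P) : (P × P) × P :=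
  (σ t.1, t.2)

/-- The map `id × σ` on triples. -/
def braidRight {P : Type*} (σ : P × P → P × P) (t : (P × P) × P) : (P × P) × P :=
  ((t.1.1, (σ (t.1.2, t.2)).1), (σ (t.1.2, t.2)).2)

theorem groupBraiding_braid {G N : Type*} [Group G] [Group N] (act : N → G → N)
    (mul_act : ∀ x y a, act (x * y) a = act x a * act y a)
    (act_mul : ∀ x a b, act x (a * b) = act (act x a) b)
    (p q r : G × N) :
    braidLeft (groupBraiding act) (braidRight (groupBraiding act)
        (braidLeft (groupBraiding act) ((p, q), r))) =
      braidRight (groupBraiding act) (braidLeft (groupBraiding act)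
        (braidRight (groupBraiding act) ((p, q), r))) := by
  have one_act (a : G) : act 1 a = 1 := by simpa using mul_act 1 1 a
  have inv_act (x : N) (a : G) : act x⁻¹ a = (act x a)⁻¹ :=
    eq_inv_of_mul_eq_one_left (by rw [← mul_act, inv_mul_cancel, one_act])
  obtain ⟨a, x⟩ := p
  obtain ⟨b, y⟩ := q
  obtain ⟨d, z⟩ := r
  simp [braidLeft, braidRight, groupBraiding, mul_act, inv_act, ← act_mul, mul_assoc]

section Solutions

variable {k}
variable {W P : Type u} [AddCommGroup W] [Module k W] [Coalgebra k W]

/-- A linear map induced by a set-theoretic braiding on points solves the braid equation. -/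
theorem solvesBraid_of_points {c : W ⊗[k] W →ₗ[k] W ⊗[k] W}
    (pt : P → (W ⊗[k] W) ⊗[k] W →ₗ[k] W) {σ : P × P → P × P}
    (hpt : ∀ f : (W ⊗[k] W) ⊗[k] W →ₗc[k] W, ∃ p, pt p = (f : (W ⊗[k] W) ⊗[k] W →ₗ[k] W))
    (hσ : ∀ p q, c ∘ₗ pair (pt p) (pt q) = pair (pt (σ (p, q)).1) (pt (σ (p, q)).2))
    (hbraid : ∀ p q r, braidLeft σ (braidRight σ (braidLeft σ ((p, q), r))) =
      braidRight σ (braidLeft σ (braidRight σ ((p, q), r)))) :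
    SolvesBraid c := by
  let E (t : (P × P) × P) := pair (pair (pt t.1.1) (pt t.1.2)) (pt t.2)
  have h₁ (t) : rTensor W c ∘ₗ E t = E (braidLeft σ t) := by
    simp only [E, rTensor_comp_pair, hσ, braidLeft]
  have h₂ (t) : ((TensorProduct.assoc k W W W).symm.toLinearMap ∘ₗ lTensor W c ∘ₗ
      (TensorProduct.assoc k W W W).toLinearMap) ∘ₗ E t = E (braidRight σ t) := by
    simp only [E, LinearMap.comp_assoc, assoc_comp_pair, lTensor_comp_pair, hσ,
      assoc_symm_comp_pair, braidRight]
  obtain ⟨p, hp⟩ := hpt ((fstHom k W W).comp (fstHom k (W ⊗[k] W) W))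
  obtain ⟨q, hq⟩ := hpt ((sndHom k W W).comp (fstHom k (W ⊗[k] W) W))
  obtain ⟨r, hr⟩ := hpt (sndHom k (W ⊗[k] W) W)
  have hid : E ((p, q), r) = LinearMap.id := by
    simp only [E, hp, hq, hr, CoalgHom.comp_toLinearMap]
    rw [← pair_comp_coalgHom, pair_fst_snd, LinearMap.id_comp, pair_fst_snd]
  unfold SolvesBraid
  rw [← LinearMap.comp_id (LinearMap.comp (rTensor W c) _), ← hid, LinearMap.comp_assoc,
    LinearMap.comp_assoc, h₁, h₂, h₁, hbraid, ← h₂, ← h₁, ← h₂, hid]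
  rfl

end Solutions

section Representations

variable {k}
variable {M N α : Type u} [AddCommMonoid M] [Module k M] [AddCommMonoid N] [Module k N]

/-- Every element of `M` is a finite sum of values of `f`. -/
def IsSumDense (f : α → M) : Prop :=
  ∀ m : M, ∃ (ι : Type u) (s : Finset ι) (g : ι → α), ∑ i ∈ s, f (g i) = m

theorem isSumDense_id : IsSumDense (fun m : M => m) :=
  fun m => ⟨PUnit, {PUnit.unit}, fun _ => m, by simp⟩

theorem IsSumDense.tmul {f : α → N} (hf : IsSumDense f) :
    IsSumDense (fun p : M × α => p.1 ⊗ₜ[k] f p.2) := by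
  intro t
  induction t with
  | zero => exact ⟨PEmpty, ∅, PEmpty.elim, by simp⟩
  | tmul m n =>
    obtain ⟨ι, s, g, rfl⟩ := hf n
    exact ⟨ι, s, fun i => (m, g i), by simp [tmul_sum]⟩
  | add t t' ht ht' =>
    obtain ⟨ι, s, g, rfl⟩ := ht
    obtain ⟨κ, s', g', rfl⟩ := ht'
    exact ⟨ι ⊕ κ, s.disjSum s', Sum.elim g g', by simp⟩

end Representations

section Braiding

open Coalgebra

variable {k}

section

variable {U M X R : Type u} [AddCommMonoid U] [Module k U] [AddCommMonoid M] [Module k M]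
  [AddCommMonoid X] [Module k X] [AddCommMonoid R] [Module k R]

variable (U) in
/-- Extend a map bringing a factor `X` to the front over a further factor `U`. -/
noncomputable def front (f : M →ₗ[k] X ⊗[k] R) : U ⊗[k] M →ₗ[k] X ⊗[k] (U ⊗[k] R) :=
  (TensorProduct.leftComm k U X R).toLinearMap ∘ₗ lTensor U f

end

variable {A H : Type u}
  [AddCommGroup A] [Module k A] [Coalgebra k A]
  [AddCommGroup H] [Module k H] [Coalgebra k H]

variable (A H) in
/-- The map sending `(a ⊗ x) ⊗ (b ⊗ y)` to
`x₍₁₎ ⊗ x₍₂₎ ⊗ x₍₃₎ ⊗ a ⊗ y ⊗ b₍₁₎ ⊗ b₍₂₎ ⊗ b₍₃₎ ⊗ b₍₄₎ ⊗ b₍₅₎`. -/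
noncomputable def expand : (A ⊗[k] H) ⊗[k] (A ⊗[k] H) →ₗ[k]
    H ⊗[k] (H ⊗[k] (H ⊗[k] (A ⊗[k] (H ⊗[k] (A ⊗[k] (A ⊗[k] (A ⊗[k] (A ⊗[k] A)))))))) :=
  lTensor H (TensorProduct.assoc k _ _ _).toLinearMap ∘ₗ
  (TensorProduct.assoc k _ _ _).toLinearMap ∘ₗ
  (TensorProduct.assoc k _ _ _).toLinearMap ∘ₗ
  TensorProduct.map
    (TensorProduct.map (lTensor H comul ∘ₗ comul) LinearMap.id ∘ₗ
      (TensorProduct.comm k A H).toLinearMap)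
    (TensorProduct.map LinearMap.id
      (lTensor A (lTensor A (lTensor A comul)) ∘ₗ lTensor A (lTensor A comul) ∘ₗ
        lTensor A comul ∘ₗ comul) ∘ₗ (TensorProduct.comm k A H).toLinearMap)

variable (A H) in
/-- The permutation of tensor factors sending
`x₁ ⊗ x₂ ⊗ x₃ ⊗ a ⊗ y ⊗ b₁ ⊗ b₂ ⊗ b₃ ⊗ b₄ ⊗ b₅` to
`b₁ ⊗ x₁ ⊗ b₂ ⊗ y ⊗ x₂ ⊗ b₃ ⊗ a ⊗ b₅ ⊗ (x₃ ⊗ b₄)`. -/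
noncomputable def shuffle :
    H ⊗[k] (H ⊗[k] (H ⊗[k] (A ⊗[k] (H ⊗[k] (A ⊗[k] (A ⊗[k] (A ⊗[k] (A ⊗[k] A)))))))) →ₗ[k]
    A ⊗[k] (H ⊗[k] (A ⊗[k] (H ⊗[k] (H ⊗[k] (A ⊗[k] (A ⊗[k] (A ⊗[k] (H ⊗[k] A)))))))) :=
  lTensor A (lTensor H (lTensor A (lTensor H (lTensor H (lTensor A (lTensor A
    ((TensorProduct.comm k _ _).toLinearMap ∘ₗ
      (TensorProduct.assoc k _ _ _).symm.toLinearMap))))))) ∘ₗ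
  lTensor A (lTensor H (lTensor A (lTensor H (lTensor H (lTensor A
    (front H LinearMap.id)))))) ∘ₗ
  lTensor A (lTensor H (lTensor A (lTensor H (lTensor H
    (front H (front A LinearMap.id)))))) ∘ₗ
  lTensor A (lTensor H (lTensor A (front H (front H (front A LinearMap.id))))) ∘ₗ
  lTensor A (lTensor H (front H (front H (front A (front H LinearMap.id))))) ∘ₗ
  front H (front H (front H (front A (front H LinearMap.id))))

/-- The map sending `b₁ ⊗ x₁ ⊗ b₂ ⊗ y ⊗ x₂ ⊗ b₃ ⊗ a ⊗ b₅ ⊗ (x₃ ⊗ b₄)` to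
`(b₁ ⊗ S(x₁ ◁ b₂)yx₂) ⊗ (T(b₃)ab₅ ⊗ T(S(x₃) ◁ b₄))`. -/
noncomputable def contract (hA : HopfStr k A) (hH : HopfStr k H) (ract : H ⊗[k] A →ₗ[k] H) :
    A ⊗[k] (H ⊗[k] (A ⊗[k] (H ⊗[k] (H ⊗[k] (A ⊗[k] (A ⊗[k] (A ⊗[k] (H ⊗[k] A)))))))) →ₗ[k]
    (A ⊗[k] H) ⊗[k] (A ⊗[k] H) :=
  (TensorProduct.assoc k A H (A ⊗[k] H)).symm.toLinearMap ∘ₗ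
  lTensor A (
    rTensor (A ⊗[k] H) hH.mul ∘ₗ
    (TensorProduct.assoc k _ _ _).symm.toLinearMap ∘ₗ
    rTensor (H ⊗[k] (A ⊗[k] H)) hH.mul ∘ₗ
    (TensorProduct.assoc k _ _ _).symm.toLinearMap ∘ₗ
    TensorProduct.map (hH.antipode ∘ₗ ract) (lTensor H (lTensor H (
      rTensor H hA.mul ∘ₗ
      (TensorProduct.assoc k _ _ _).symm.toLinearMap ∘ₗ
      TensorProduct.map hA.mul
        (lTensor A (hH.antipode ∘ₗ ract ∘ₗ rTensor A hH.antipode)) ∘ₗ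
      (TensorProduct.assoc k _ _ _).symm.toLinearMap ∘ₗ
      rTensor _ hA.antipode))) ∘ₗ
    (TensorProduct.assoc k _ _ _).symm.toLinearMap)

/-- The map `c` of the theorem, written as a composite of structure maps. -/
noncomputable def braiding (hA : HopfStr k A) (hH : HopfStr k H) (ract : H ⊗[k] A →ₗ[k] H) :
    (A ⊗[k] H) ⊗[k] (A ⊗[k] H) →ₗ[k] (A ⊗[k] H) ⊗[k] (A ⊗[k] H) :=
  contract hA hH ract ∘ₗ shuffle A H ∘ₗ expand A H

theorem braiding_tmul (hA : HopfStr k A) (hH : HopfStr k H) (ract : H ⊗[k] A →ₗ[k] H)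
    (a b : A) (x y : H) {ι κ : Type u} (s : Finset ι) (t : Finset κ)
    (b1 b2 b3 b4 b5 : ι → A) (x1 x2 x3 : κ → H)
    (hb : ∑ i ∈ s, b1 i ⊗ₜ[k] (b2 i ⊗ₜ[k] (b3 i ⊗ₜ[k] (b4 i ⊗ₜ[k] b5 i))) =
      lTensor A (lTensor A (lTensor A (comul (R := k))))
        (lTensor A (lTensor A (comul (R := k)))
          (lTensor A (comul (R := k)) (comul (R := k) b))))
    (hx : ∑ j ∈ t, x1 j ⊗ₜ[k] (x2 j ⊗ₜ[k] x3 j) =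
      lTensor H (comul (R := k)) (comul (R := k) x)) :
    braiding hA hH ract ((a ⊗ₜ[k] x) ⊗ₜ[k] (b ⊗ₜ[k] y)) =
      ∑ i ∈ s, ∑ j ∈ t,
        (b1 i ⊗ₜ[k]
            hH.mul (hH.mul (hH.antipode (ract (x1 j ⊗ₜ[k] b2 i)) ⊗ₜ[k] y) ⊗ₜ[k] x2 j)) ⊗ₜ[k]
          (hA.mul (hA.mul (hA.antipode (b3 i) ⊗ₜ[k] a) ⊗ₜ[k] b5 i) ⊗ₜ[k]
            hH.antipode (ract (hH.antipode (x3 j) ⊗ₜ[k] b4 i))) := by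
  have he : expand A H ((a ⊗ₜ[k] x) ⊗ₜ[k] (b ⊗ₜ[k] y)) =
      ∑ i ∈ s, ∑ j ∈ t, x1 j ⊗ₜ[k] (x2 j ⊗ₜ[k] (x3 j ⊗ₜ[k] (a ⊗ₜ[k] (y ⊗ₜ[k]
        (b1 i ⊗ₜ[k] (b2 i ⊗ₜ[k] (b3 i ⊗ₜ[k] (b4 i ⊗ₜ[k] b5 i)))))))) := by
    simp [expand, ← hb, ← hx, tmul_sum, sum_tmul]
  simp [braiding, he, shuffle, front, contract]

theorem braiding_comp_pair (hA : HopfStr k A) (hH : HopfStr k H) (ract : H ⊗[k] A →ₗ[k] H)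
    {C : Type u} [AddCommMonoid C] [Module k C] [Coalgebra k C] [Coalgebra.IsCocomm k C]
    (a b : C →ₗc[k] A) (x y : C →ₗc[k] H) :
    braiding hA hH ract ∘ₗ pair (pair (a : C →ₗ[k] A) (x : C →ₗ[k] H))
        (pair (b : C →ₗ[k] A) (y : C →ₗ[k] H)) =
      pair
        (pair (b : C →ₗ[k] A) (hH.mul ∘ₗ pair (hH.mul ∘ₗ pair
          (hH.antipode ∘ₗ ract ∘ₗ pair (x : C →ₗ[k] H) (b : C →ₗ[k] A)) (y : C →ₗ[k] H))
            (x : C →ₗ[k] H)))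
        (pair
          (hA.mul ∘ₗ pair (hA.mul ∘ₗ pair (hA.antipode ∘ₗ (b : C →ₗ[k] A)) (a : C →ₗ[k] A))
            (b : C →ₗ[k] A))
          (hH.antipode ∘ₗ ract ∘ₗ pair (hH.antipode ∘ₗ (x : C →ₗ[k] H)) (b : C →ₗ[k] A))) := by
  simp only [braiding, expand, shuffle, front, contract, LinearMap.comp_assoc, map_comp_pair,
    lTensor_comp_pair, rTensor_comp_pair, comm_comp_pair, assoc_comp_pair, assoc_symm_comp_pair,
    leftComm_comp_pair, comul_comp_coalgHom, LinearMap.id_comp]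

/-- The points of `A ⊗ H` with values in a cocommutative coalgebra carry a set-theoretic braiding
inducing `braiding`. -/
theorem exists_points_braiding (C : Type u) [AddCommMonoid C] [Module k C] [Coalgebra k C]
    [Coalgebra.IsCocomm k C] [Coalgebra.IsCocomm k A] [Coalgebra.IsCocomm k H]
    {hA : HopfStr k A} {hH : HopfStr k H} {ract : H ⊗[k] A →ₗ[k] H}
    (hmb : IsRightModuleBialgebra hA hH ract) :
    ∃ (P : Type u) (pt : P → C →ₗ[k] A ⊗[k] H) (σ : P × P → P × P),
      (∀ f : C →ₗc[k] A ⊗[k] H, ∃ p, pt p = (f : C →ₗ[k] A ⊗[k] H)) ∧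
      (∀ p q, braiding hA hH ract ∘ₗ pair (pt p) (pt q) =
        pair (pt (σ (p, q)).1) (pt (σ (p, q)).2)) ∧
      ∀ p q r, braidLeft σ (braidRight σ (braidLeft σ ((p, q), r))) =
        braidRight σ (braidLeft σ (braidRight σ ((p, q), r))) := by
  let _ : Group (C →ₗc[k] A) := hA.pointGroup
  let _ : Group (C →ₗc[k] H) := hH.pointGroup
  refine ⟨(C →ₗc[k] A) × (C →ₗc[k] H), fun p => pair (p.1 : C →ₗ[k] A) (p.2 : C →ₗ[k] H),
    groupBraiding hmb.toCoalgLaw.pointAct,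
    fun f => ⟨((fstHom k A H).comp f, (sndHom k A H).comp f), ?_⟩,
    fun p q => braiding_comp_pair hA hH ract p.1 q.1 p.2 q.2,
    groupBraiding_braid _ hmb.mul_pointAct hmb.pointAct_mul⟩
  change pair ((fstHom k A H : A ⊗[k] H →ₗ[k] A) ∘ₗ (f : C →ₗ[k] A ⊗[k] H))
    ((sndHom k A H : A ⊗[k] H →ₗ[k] H) ∘ₗ (f : C →ₗ[k] A ⊗[k] H)) = _
  rw [← pair_comp_coalgHom, pair_fst_snd, LinearMap.id_comp]

theorem solvesBraid_braiding [Coalgebra.IsCocomm k A] [Coalgebra.IsCocomm k H]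
    {hA : HopfStr k A} {hH : HopfStr k H} {ract : H ⊗[k] A →ₗ[k] H}
    (hmb : IsRightModuleBialgebra hA hH ract) : SolvesBraid (braiding hA hH ract) := by
  obtain ⟨P, pt, σ, hpt, hσ, hbraid⟩ :=
    exists_points_braiding (((A ⊗[k] H) ⊗[k] (A ⊗[k] H)) ⊗[k] (A ⊗[k] H)) hmb
  exact solvesBraid_of_points pt hpt hσ hbraid

end Braiding

/-- For the cocommutative Hopf brace on `A ⊗ H` of Example `gen 3)`
(`(a ⊗ x)(b ⊗ y) = ab₍₁₎ ⊗ (x ◁ b₍₂₎)y` and `(a ⊗ x) ∘ (b ⊗ y) = ab ⊗ yx`), the map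
`c((a ⊗ x) ⊗ (b ⊗ y)) = (b₍₁₎ ⊗ S(x₍₁₎ ◁ b₍₂₎)yx₍₂₎) ⊗ (T(b₍₃₎)ab₍₅₎ ⊗ T(S(x₍₃₎) ◁ b₍₄₎))`
is a solution of the braid equation.  The Sweedler components are encoded by quantifying over
all finite representations of the iterated comultiplications of `b` and `x`. -/
theorem statement11 {k : Type u} [Field k]
    {A H : Type u} [AddCommGroup A] [Module k A] [Coalgebra k A]
    [AddCommGroup H] [Module k H] [Coalgebra k H]
    (hA : HopfStr k A) (hH : HopfStr k H)
    (hAcocomm : IsCocomm k A) (hHcocomm : IsCocomm k H)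
    (ract : H ⊗[k] A →ₗ[k] H)
    (hmb : IsRightModuleBialgebra hA hH ract)
    (B : HopfBrace k (A ⊗[k] H))
    (hdot : ∀ (a b : A) (x y : H),
      B.dot.mul ((a ⊗ₜ[k] x) ⊗ₜ[k] (b ⊗ₜ[k] y)) =
        sandwich k hA.mul hH.mul ((a ⊗ₜ[k] rsmashEl ract x b) ⊗ₜ[k] y))
    (hcirc : ∀ (a b : A) (x y : H),
      B.circ.mul ((a ⊗ₜ[k] x) ⊗ₜ[k] (b ⊗ₜ[k] y)) =
        hA.mul (a ⊗ₜ[k] b) ⊗ₜ[k] hH.mul (y ⊗ₜ[k] x))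
    (c : (A ⊗[k] H) ⊗[k] (A ⊗[k] H) →ₗ[k] (A ⊗[k] H) ⊗[k] (A ⊗[k] H))
    (hc : ∀ (a b : A) (x y : H) (ι κ : Type u) (s : Finset ι) (t : Finset κ)
      (b1 b2 b3 b4 b5 : ι → A) (x1 x2 x3 : κ → H),
      (∑ i ∈ s, b1 i ⊗ₜ[k] (b2 i ⊗ₜ[k] (b3 i ⊗ₜ[k] (b4 i ⊗ₜ[k] b5 i))) =
        lTensor A (lTensor A (lTensor A (Coalgebra.comul (R := k))))
          (lTensor A (lTensor A (Coalgebra.comul (R := k)))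
            (lTensor A (Coalgebra.comul (R := k)) (Coalgebra.comul (R := k) b)))) →
      (∑ j ∈ t, x1 j ⊗ₜ[k] (x2 j ⊗ₜ[k] x3 j) =
        lTensor H (Coalgebra.comul (R := k)) (Coalgebra.comul (R := k) x)) →
      c ((a ⊗ₜ[k] x) ⊗ₜ[k] (b ⊗ₜ[k] y)) =
        ∑ i ∈ s, ∑ j ∈ t,
          (b1 i ⊗ₜ[k]
              hH.mul (hH.mul (hH.antipode (ract (x1 j ⊗ₜ[k] b2 i)) ⊗ₜ[k] y) ⊗ₜ[k] x2 j)) ⊗ₜ[k]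
            (hA.mul (hA.mul (hA.antipode (b3 i) ⊗ₜ[k] a) ⊗ₜ[k] b5 i) ⊗ₜ[k]
              hH.antipode (ract (hH.antipode (x3 j) ⊗ₜ[k] b4 i)))) :
    SolvesBraid c := by
  have : Coalgebra.IsCocomm k A := ⟨hAcocomm⟩
  have : Coalgebra.IsCocomm k H := ⟨hHcocomm⟩
  have hcb : c = braiding hA hH ract := by
    ext a x b y
    obtain ⟨ι, s, g, hb⟩ := (isSumDense_id.tmul (k := k)).tmul.tmul.tmul
      (lTensor A (lTensor A (lTensor A (Coalgebra.comul (R := k))))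
        (lTensor A (lTensor A (Coalgebra.comul (R := k)))
          (lTensor A (Coalgebra.comul (R := k)) (Coalgebra.comul (R := k) b))))
    obtain ⟨κ, t, l, hx⟩ := (isSumDense_id.tmul (k := k)).tmul
      (lTensor H (Coalgebra.comul (R := k)) (Coalgebra.comul (R := k) x))
    exact (hc a b x y ι κ s t _ _ _ _ _ _ _ _ hb hx).trans
      (braiding_tmul hA hH ract a b x y s t _ _ _ _ _ _ _ _ hb hx).symm
  exact hcb ▸ solvesBraid_braiding hmb

end HopfBraceNL
end

section
/- Let (G, H, ⇀, ↼) be a matched pair of groups and let k be a field. Then the k-linear extensions of ⇀: H × G → G and ↼: H × G → H make (k[G], k[H], ⇀, ↼) a matched pair of Hopf algebras between the group Hopf algebras, and consequently the tensor product coalgebra k[G] ⊗ k[H], equipped with the multiplications determined on group elements by (g ⊗ h)(g' ⊗ h') = g(h ⇀ g') ⊗ (h ↼ g')h' and (g ⊗ h) ∘ (g' ⊗ h') = gg' ⊗ h'h, is a cocommutative Hopf brace. -/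
/-! Common definitions for formalizing "Constructing Hopf braces" (Agore). -/

open TensorProduct LinearMap

namespace HopfBraceNL

universe u

variable (k : Type u) [Field k]

section GroupLike

open Module

variable {k}

/-- Induction on a vector space along the elements of a basis. -/
theorem basis_induction {X V : Type*} [AddCommGroup V] [Module k V] (b : Basis X k V)
    {P : V → Prop} (v : V) (basis : ∀ x, P (b x)) (add : ∀ u v, P u → P v → P (u + v))
    (smul : ∀ (t : k) u, P u → P (t • u)) (zero : P 0) : P v := by
  have hv : v ∈ Submodule.span k (Set.range b) := by simp [b.span_eq]
  induction hv using Submodule.span_induction with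
  | mem x hx => obtain ⟨y, rfl⟩ := hx; exact basis y
  | zero => exact zero
  | add x y _ _ hx hy => exact add x y hx hy
  | smul t x _ hx => exact smul t x hx

/-- The linear map on a tensor product with prescribed values on pairs of basis elements. -/
noncomputable def tensorConstr {X Y V W U : Type*} [AddCommGroup V] [Module k V]
    [AddCommGroup W] [Module k W] [AddCommGroup U] [Module k U]
    (b : Basis X k V) (c : Basis Y k W) (f : X → Y → U) : V ⊗[k] W →ₗ[k] U :=
  (b.tensorProduct c).constr k fun p => f p.1 p.2

@[simp]
theorem tensorConstr_tmul {X Y V W U : Type*} [AddCommGroup V] [Module k V]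
    [AddCommGroup W] [Module k W] [AddCommGroup U] [Module k U]
    (b : Basis X k V) (c : Basis Y k W) (f : X → Y → U) (x : X) (y : Y) :
    tensorConstr b c f (b x ⊗ₜ[k] c y) = f x y := by
  rw [tensorConstr, ← Basis.tensorProduct_apply, Basis.constr_basis]

/-- All elements of the basis `b` are group-like. -/
structure IsGroupLikeBasis {X V : Type*} [AddCommGroup V] [Module k V] [Coalgebra k V]
    (b : Basis X k V) : Prop where
  comul_apply : ∀ x, Coalgebra.comul (R := k) (b x) = b x ⊗ₜ[k] b x
  counit_apply : ∀ x, Coalgebra.counit (R := k) (b x) = 1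

theorem IsGroupLikeBasis.tensorProduct {X Y V W : Type*}
    [AddCommGroup V] [Module k V] [Coalgebra k V] [AddCommGroup W] [Module k W] [Coalgebra k W]
    {b : Basis X k V} {c : Basis Y k W} (hb : IsGroupLikeBasis b) (hc : IsGroupLikeBasis c) :
    IsGroupLikeBasis (b.tensorProduct c) where
  comul_apply := by
    rintro ⟨x, y⟩
    simp [TensorProduct.comul_tmul, hb.comul_apply, hc.comul_apply]
  counit_apply := by
    rintro ⟨x, y⟩
    simp [TensorProduct.counit_tmul, hb.counit_apply, hc.counit_apply]

theorem IsGroupLikeBasis.isCocomm {X V : Type u} [AddCommGroup V] [Module k V] [Coalgebra k V]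
    {b : Basis X k V} (hb : IsGroupLikeBasis b) : IsCocomm k V :=
  b.ext fun x => by simp [hb.comul_apply]

/-- A group structure on a basis of group-like elements extends to a Hopf algebra structure. -/
noncomputable def IsGroupLikeBasis.hopfStr {X V : Type u} [AddCommGroup V] [Module k V]
    [Coalgebra k V] {b : Basis X k V} (hb : IsGroupLikeBasis b) (grp : Group X) :
    HopfStr k V where
  mul := tensorConstr b b fun x y => b (x * y)
  one := b 1
  mul_assoc u v w := by
    induction u using basis_induction b with
    | basis x =>
      induction v using basis_induction b with
      | basis y =>
        induction w using basis_induction b with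
        | basis z => simp [mul_assoc]
        | _ => simp_all [tmul_add]
      | _ => simp_all [tmul_add, add_tmul, ← smul_tmul']
    | _ => simp_all [add_tmul, ← smul_tmul']
  one_mul u := by
    induction u using basis_induction b with
    | basis x => simp
    | _ => simp_all [tmul_add]
  mul_one u := by
    induction u using basis_induction b with
    | basis x => simp
    | _ => simp_all [add_tmul, ← smul_tmul']
  comul_mul u v := by
    induction u using basis_induction b with
    | basis x =>
      induction v using basis_induction b with
      | basis y => simp [hb.comul_apply]
      | _ => simp_all [tmul_add]
    | _ => simp_all [add_tmul, ← smul_tmul']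
  counit_mul u v := by
    induction u using basis_induction b with
    | basis x =>
      induction v using basis_induction b with
      | basis y => simp [hb.counit_apply]
      | _ => simp_all [tmul_add, mul_add, mul_left_comm]
    | _ => simp_all [add_tmul, add_mul, mul_assoc, ← smul_tmul']
  comul_one := hb.comul_apply 1
  counit_one := hb.counit_apply 1
  antipode := b.constr k fun x => b x⁻¹
  antipode_left := b.ext fun x => by simp [hb.comul_apply, hb.counit_apply]
  antipode_right := b.ext fun x => by simp [hb.comul_apply, hb.counit_apply]

theorem IsGroupLikeBasis.hopfStr_mul_tmul {X V : Type u} [AddCommGroup V] [Module k V]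
    [Coalgebra k V] {b : Basis X k V} (hb : IsGroupLikeBasis b) (grp : Group X) (x y : X) :
    (hb.hopfStr grp).mul (b x ⊗ₜ[k] b y) = b (x * y) := by
  simp only [IsGroupLikeBasis.hopfStr, tensorConstr_tmul]

/-- A skew brace structure on a basis of group-like elements extends to a Hopf brace. -/
noncomputable def IsGroupLikeBasis.hopfBrace {X V : Type u} [AddCommGroup V] [Module k V]
    [Coalgebra k V] {b : Basis X k V} (hb : IsGroupLikeBasis b) (dot circ : Group X)
    (brace : ∀ x y z : X, circ.mul x (dot.mul y z) =
      dot.mul (circ.mul x y) (dot.mul (dot.inv x) (circ.mul x z))) :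
    HopfBrace k V where
  dot := hb.hopfStr dot
  circ := hb.hopfStr circ
  brace := (b.tensorProduct (b.tensorProduct b)).ext fun ⟨x, y, z⟩ => by
    simp only [braceRHS, IsGroupLikeBasis.hopfStr, Basis.tensorProduct_apply, coe_comp,
      Function.comp_apply, lTensor_tmul, rTensor_tmul, tensorConstr_tmul, hb.comul_apply,
      LinearEquiv.coe_coe, tensorTensorTensorComm_tmul, TensorProduct.assoc_tmul,
      TensorProduct.map_tmul, Basis.constr_basis]
    exact congrArg b (brace x y z)

/-- A matched pair of groups extends to a matched pair of Hopf algebras. -/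
theorem IsGroupLikeBasis.isMatchedPair {G Γ A H : Type u} [Group G] [Group Γ]
    [AddCommGroup A] [Module k A] [Coalgebra k A] [AddCommGroup H] [Module k H] [Coalgebra k H]
    {b : Basis G k A} {c : Basis Γ k H} (hb : IsGroupLikeBasis b) (hc : IsGroupLikeBasis c)
    (hA : HopfStr k A) (hH : HopfStr k H)
    (hAmul : ∀ g g', hA.mul (b g ⊗ₜ[k] b g') = b (g * g')) (hAone : hA.one = b 1)
    (hHmul : ∀ h h', hH.mul (c h ⊗ₜ[k] c h') = c (h * h')) (hHone : hH.one = c 1)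
    (l : Γ → G → G) (r : Γ → G → Γ)
    (hl_one : ∀ g : G, l 1 g = g)
    (hl_mul : ∀ (h h' : Γ) (g : G), l (h * h') g = l h (l h' g))
    (hr_one : ∀ h : Γ, r h 1 = h)
    (hr_mul : ∀ (h : Γ) (g g' : G), r h (g * g') = r (r h g) g')
    (hmpG : ∀ (h : Γ) (g g' : G), l h (g * g') = l h g * l (r h g) g')
    (hmpΓ : ∀ (h h' : Γ) (g : G), r (h * h') g = r h (l h' g) * r h' g)
    (hl_one' : ∀ h : Γ, l h 1 = 1)
    (hr_one' : ∀ g : G, r 1 g = 1) :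
    IsMatchedPair hA hH (tensorConstr c b fun h g => b (l h g))
      (tensorConstr c b fun h g => c (r h g)) where
  tri_module :=
    { one_act := fun a => by
        induction a using basis_induction b with
        | basis g => simp [hHone, hl_one]
        | _ => simp_all [tmul_add]
      mul_act := fun x y a => by
        induction x using basis_induction c with
        | basis h =>
          induction y using basis_induction c with
          | basis h' =>
            induction a using basis_induction b with
            | basis g => simp [hHmul, hl_mul]
            | _ => simp_all [tmul_add]
          | _ => simp_all [tmul_add, add_tmul, ← smul_tmul']
        | _ => simp_all [add_tmul, ← smul_tmul'] }
  tri_coalg :=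
    { comul_act := fun x a => by
        induction x using basis_induction c with
        | basis h =>
          induction a using basis_induction b with
          | basis g => simp [split, hb.comul_apply, hc.comul_apply]
          | _ => simp_all [split, tmul_add]
        | _ => simp_all [split, add_tmul, ← smul_tmul']
      counit_act := fun x a => by
        induction x using basis_induction c with
        | basis h =>
          induction a using basis_induction b with
          | basis g => simp [hb.counit_apply, hc.counit_apply]
          | _ => simp_all [tmul_add, mul_add, mul_left_comm]
        | _ => simp_all [add_tmul, add_mul, mul_assoc, ← smul_tmul'] }
  quad_module :=
    { act_one := fun x => by
        induction x using basis_induction c with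
        | basis h => simp [hAone, hr_one]
        | _ => simp_all [add_tmul, ← smul_tmul']
      act_mul := fun x a a' => by
        induction x using basis_induction c with
        | basis h =>
          induction a using basis_induction b with
          | basis g =>
            induction a' using basis_induction b with
            | basis g' => simp [hAmul, hr_mul]
            | _ => simp_all [tmul_add]
          | _ => simp_all [tmul_add, add_tmul, ← smul_tmul']
        | _ => simp_all [add_tmul, ← smul_tmul'] }
  quad_coalg :=
    { comul_act := fun x a => by
        induction x using basis_induction c with
        | basis h =>
          induction a using basis_induction b with
          | basis g => simp [split, hb.comul_apply, hc.comul_apply]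
          | _ => simp_all [split, tmul_add]
        | _ => simp_all [split, add_tmul, ← smul_tmul']
      counit_act := fun x a => by
        induction x using basis_induction c with
        | basis h =>
          induction a using basis_induction b with
          | basis g => simp [hb.counit_apply, hc.counit_apply]
          | _ => simp_all [tmul_add, mul_add, mul_left_comm]
        | _ => simp_all [add_tmul, add_mul, mul_assoc, ← smul_tmul'] }
  mp1 x := by
    induction x using basis_induction c with
    | basis h => simp [hAone, hl_one', hc.counit_apply]
    | _ => simp_all [add_tmul, add_smul, mul_smul, ← smul_tmul']
  mp1' a := by
    induction a using basis_induction b with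
    | basis g => simp [hHone, hr_one', hb.counit_apply]
    | _ => simp_all [tmul_add, add_smul, mul_smul]
  mp2 x a a' := by
    induction x using basis_induction c with
    | basis h =>
      induction a using basis_induction b with
      | basis g =>
        induction a' using basis_induction b with
        | basis g' => simp [split, hb.comul_apply, hc.comul_apply, hAmul, hmpG]
        | _ => simp_all [tmul_add]
      | _ => simp_all [split, tmul_add, add_tmul, ← smul_tmul']
    | _ => simp_all [split, add_tmul, ← smul_tmul']
  mp3 x y a := by
    induction x using basis_induction c with
    | basis h =>
      induction y using basis_induction c with
      | basis h' =>
        induction a using basis_induction b with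
        | basis g => simp [split, hb.comul_apply, hc.comul_apply, hHmul, hmpΓ]
        | _ => simp_all [split, tmul_add]
      | _ => simp_all [split, tmul_add, add_tmul, ← smul_tmul']
    | _ => simp_all [add_tmul, ← smul_tmul']
  mp4 x a := by
    induction x using basis_induction c with
    | basis h =>
      induction a using basis_induction b with
      | basis g => simp [split, hb.comul_apply, hc.comul_apply]
      | _ => simp_all [split, tmul_add]
    | _ => simp_all [split, add_tmul, ← smul_tmul']

end GroupLike

/-- The bicrossed product group of a matched pair of groups. -/
@[reducible]
def bicrossedGroup {G Γ : Type*} [Group G] [Group Γ] (l : Γ → G → G) (r : Γ → G → Γ)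
    (hl_one : ∀ g : G, l 1 g = g)
    (hl_mul : ∀ (h h' : Γ) (g : G), l (h * h') g = l h (l h' g))
    (hr_one : ∀ h : Γ, r h 1 = h)
    (hr_mul : ∀ (h : Γ) (g g' : G), r h (g * g') = r (r h g) g')
    (hmpG : ∀ (h : Γ) (g g' : G), l h (g * g') = l h g * l (r h g) g')
    (hmpΓ : ∀ (h h' : Γ) (g : G), r (h * h') g = r h (l h' g) * r h' g)
    (hl_one' : ∀ h : Γ, l h 1 = 1)
    (hr_one' : ∀ g : G, r 1 g = 1) : Group (G × Γ) := by
  refine @Group.ofLeftAxioms (G × Γ) ⟨fun x y => (x.1 * l x.2 y.1, r x.2 y.1 * y.2)⟩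
    ⟨fun x => (l x.2⁻¹ x.1⁻¹, r x.2⁻¹ x.1⁻¹)⟩ ⟨(1, 1)⟩ ?_ ?_ ?_
  · rintro ⟨a, b⟩ ⟨c, d⟩ ⟨e, f⟩
    change (a * l b c * l (r b c * d) e, r (r b c * d) e * f) =
      (a * l b (c * l d e), r b (c * l d e) * (r d e * f))
    simp only [hmpG, hmpΓ, hl_mul, hr_mul, mul_assoc]
  · rintro ⟨a, b⟩
    change (1 * l 1 a, r 1 a * b) = (a, b)
    simp [hl_one, hr_one']
  · rintro ⟨a, b⟩
    change (l b⁻¹ a⁻¹ * l (r b⁻¹ a⁻¹) a, r (r b⁻¹ a⁻¹) a * b) = (1, 1)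
    rw [← hmpG, ← hr_mul]
    simp [hl_one', hr_one]

/-- The product group of `G` and the opposite of `Γ`, on the set `G × Γ`. -/
@[reducible]
def prodOppositeGroup (G Γ : Type*) [Group G] [Group Γ] : Group (G × Γ) :=
  ((Equiv.refl G).prodCongr MulOpposite.opEquiv : G × Γ ≃ G × Γᵐᵒᵖ).group

theorem two_sided_mul_brace {X : Type*} [Group X] (a d y z : X) :
    a * (y * z) * d = a * y * d * ((a * d)⁻¹ * (a * z * d)) := by
  group

/-- The bicrossed product and the product with the opposite group form a skew brace. -/
theorem bicrossedGroup_brace {G Γ : Type*} [Group G] [Group Γ] (l : Γ → G → G) (r : Γ → G → Γ)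
    (hl_one : ∀ g : G, l 1 g = g)
    (hl_mul : ∀ (h h' : Γ) (g : G), l (h * h') g = l h (l h' g))
    (hr_one : ∀ h : Γ, r h 1 = h)
    (hr_mul : ∀ (h : Γ) (g g' : G), r h (g * g') = r (r h g) g')
    (hmpG : ∀ (h : Γ) (g g' : G), l h (g * g') = l h g * l (r h g) g')
    (hmpΓ : ∀ (h h' : Γ) (g : G), r (h * h') g = r h (l h' g) * r h' g)
    (hl_one' : ∀ h : Γ, l h 1 = 1)
    (hr_one' : ∀ g : G, r 1 g = 1) (x y z : G × Γ) :
    letI dot := bicrossedGroup l r hl_one hl_mul hr_one hr_mul hmpG hmpΓ hl_one' hr_one'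
    letI circ := prodOppositeGroup G Γ
    circ.mul x (dot.mul y z) =
      dot.mul (circ.mul x y) (dot.mul (dot.inv x) (circ.mul x z)) := by
  let dot := bicrossedGroup l r hl_one hl_mul hr_one hr_mul hmpG hmpΓ hl_one' hr_one'
  have circ_eq (y : G × Γ) :
      (prodOppositeGroup G Γ).mul x y = dot.mul (dot.mul (x.1, 1) y) (1, x.2) := by
    change (x.1 * y.1, y.2 * x.2) =
      (x.1 * l 1 y.1 * l (r 1 y.1 * y.2) 1, r (r 1 y.1 * y.2) 1 * x.2)
    simp [hl_one, hl_one', hr_one, hr_one']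
  have eq_mul : dot.mul (x.1, 1) (1, x.2) = x := by
    change (x.1 * l 1 1, r 1 1 * x.2) = x
    simp [hl_one, hr_one]
  rw [circ_eq, circ_eq, circ_eq]
  refine (@two_sided_mul_brace _ dot (x.1, 1) (1, x.2) y z).trans ?_
  exact congrArg (fun w => dot.mul (dot.mul (dot.mul (x.1, 1) y) (1, x.2))
    (dot.mul (dot.inv w) (dot.mul (dot.mul (x.1, 1) z) (1, x.2)))) eq_mul

/-- Any matched pair of groups `(G, Γ, ⇀, ↼)` extends (by `k`-linearity) to a
matched pair of Hopf algebras between the group Hopf algebras `k[G]`, `k[Γ]`, and consequently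
the tensor product coalgebra `k[G] ⊗ k[Γ]` with
`(g ⊗ h)(g' ⊗ h') = g(h ⇀ g') ⊗ (h ↼ g')h'` and `(g ⊗ h) ∘ (g' ⊗ h') = gg' ⊗ h'h` (on group
elements) is a cocommutative Hopf brace.  The group Hopf algebra structures (grouplike
comultiplication, convolution product, inversion antipode) are taken as hypotheses. -/
theorem statement14 {k : Type u} [Field k]
    {G Γ : Type u} [Group G] [Group Γ]
    (l : Γ → G → G) (r : Γ → G → Γ)
    -- `⇀` is a left action of `Γ` on the set `G`, `↼` is a right action of `G` on the set `Γ`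
    (hl_one : ∀ g : G, l 1 g = g)
    (hl_mul : ∀ (h h' : Γ) (g : G), l (h * h') g = l h (l h' g))
    (hr_one : ∀ h : Γ, r h 1 = h)
    (hr_mul : ∀ (h : Γ) (g g' : G), r h (g * g') = r (r h g) g')
    -- matched pair conditions
    (hmpG : ∀ (h : Γ) (g g' : G), l h (g * g') = l h g * l (r h g) g')
    (hmpΓ : ∀ (h h' : Γ) (g : G), r (h * h') g = r h (l h' g) * r h' g)
    (hl_one' : ∀ h : Γ, l h 1 = 1)
    (hr_one' : ∀ g : G, r 1 g = 1)
    -- the group Hopf algebra structures on `k[G]` and `k[Γ]`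
    [Coalgebra k (MonoidAlgebra k G)] [Coalgebra k (MonoidAlgebra k Γ)]
    (hcoG : ∀ g : G, Coalgebra.comul (R := k) (MonoidAlgebra.of k G g) =
      MonoidAlgebra.of k G g ⊗ₜ[k] MonoidAlgebra.of k G g)
    (hctG : ∀ g : G, Coalgebra.counit (R := k) (MonoidAlgebra.of k G g) = 1)
    (hcoΓ : ∀ h : Γ, Coalgebra.comul (R := k) (MonoidAlgebra.of k Γ h) =
      MonoidAlgebra.of k Γ h ⊗ₜ[k] MonoidAlgebra.of k Γ h)
    (hctΓ : ∀ h : Γ, Coalgebra.counit (R := k) (MonoidAlgebra.of k Γ h) = 1)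
    (hG : HopfStr k (MonoidAlgebra k G)) (hΓ : HopfStr k (MonoidAlgebra k Γ))
    (hGmul : ∀ u v : MonoidAlgebra k G, hG.mul (u ⊗ₜ[k] v) = u * v)
    (hGone : hG.one = 1)
    (hGanti : ∀ g : G, hG.antipode (MonoidAlgebra.of k G g) = MonoidAlgebra.of k G g⁻¹)
    (hΓmul : ∀ u v : MonoidAlgebra k Γ, hΓ.mul (u ⊗ₜ[k] v) = u * v)
    (hΓone : hΓ.one = 1)
    (hΓanti : ∀ h : Γ, hΓ.antipode (MonoidAlgebra.of k Γ h) = MonoidAlgebra.of k Γ h⁻¹) :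
    ∃ (tri : MonoidAlgebra k Γ ⊗[k] MonoidAlgebra k G →ₗ[k] MonoidAlgebra k G)
      (quad : MonoidAlgebra k Γ ⊗[k] MonoidAlgebra k G →ₗ[k] MonoidAlgebra k Γ),
      (∀ (h : Γ) (g : G),
        tri (MonoidAlgebra.of k Γ h ⊗ₜ[k] MonoidAlgebra.of k G g) =
          MonoidAlgebra.of k G (l h g)) ∧
      (∀ (h : Γ) (g : G),
        quad (MonoidAlgebra.of k Γ h ⊗ₜ[k] MonoidAlgebra.of k G g) =
          MonoidAlgebra.of k Γ (r h g)) ∧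
      IsMatchedPair hG hΓ tri quad ∧
      ∃ B : HopfBrace k (MonoidAlgebra k G ⊗[k] MonoidAlgebra k Γ),
        (∀ (g g' : G) (h h' : Γ),
          B.dot.mul ((MonoidAlgebra.of k G g ⊗ₜ[k] MonoidAlgebra.of k Γ h) ⊗ₜ[k]
              (MonoidAlgebra.of k G g' ⊗ₜ[k] MonoidAlgebra.of k Γ h')) =
            MonoidAlgebra.of k G (g * l h g') ⊗ₜ[k] MonoidAlgebra.of k Γ (r h g' * h')) ∧
        (∀ (g g' : G) (h h' : Γ),
          B.circ.mul ((MonoidAlgebra.of k G g ⊗ₜ[k] MonoidAlgebra.of k Γ h) ⊗ₜ[k]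
              (MonoidAlgebra.of k G g' ⊗ₜ[k] MonoidAlgebra.of k Γ h')) =
            MonoidAlgebra.of k G (g * g') ⊗ₜ[k] MonoidAlgebra.of k Γ (h' * h)) ∧
        IsCocomm k (MonoidAlgebra k G ⊗[k] MonoidAlgebra k Γ) := by
  obtain ⟨b, b_apply⟩ : ∃ b : Module.Basis G k (MonoidAlgebra k G),
      ∀ g, b g = MonoidAlgebra.of k G g := ⟨MonoidAlgebra.basis G k, fun g => by simp⟩
  obtain ⟨c, c_apply⟩ : ∃ c : Module.Basis Γ k (MonoidAlgebra k Γ),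
      ∀ h, c h = MonoidAlgebra.of k Γ h := ⟨MonoidAlgebra.basis Γ k, fun h => by simp⟩
  have hb : IsGroupLikeBasis b :=
    ⟨fun g => by rw [b_apply, hcoG], fun g => by rw [b_apply, hctG]⟩
  have hc : IsGroupLikeBasis c :=
    ⟨fun h => by rw [c_apply, hcoΓ], fun h => by rw [c_apply, hctΓ]⟩
  simp only [← b_apply, ← c_apply]
  refine ⟨tensorConstr c b fun h g => b (l h g), tensorConstr c b fun h g => c (r h g),
    fun h g => tensorConstr_tmul .., fun h g => tensorConstr_tmul .., ?_,
    (hb.tensorProduct hc).hopfBrace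
      (bicrossedGroup l r hl_one hl_mul hr_one hr_mul hmpG hmpΓ hl_one' hr_one')
      (prodOppositeGroup G Γ)
      (bicrossedGroup_brace l r hl_one hl_mul hr_one hr_mul hmpG hmpΓ hl_one' hr_one'), ?_, ?_,
    (hb.tensorProduct hc).isCocomm⟩
  · exact hb.isMatchedPair hc hG hΓ (fun g g' => by simp only [hGmul, b_apply, map_mul])
      (by rw [hGone, b_apply, map_one]) (fun h h' => by simp only [hΓmul, c_apply, map_mul])
      (by rw [hΓone, c_apply, map_one])
      l r hl_one hl_mul hr_one hr_mul hmpG hmpΓ hl_one' hr_one'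
  · intro g g' h h'
    simp only [IsGroupLikeBasis.hopfBrace, ← Module.Basis.tensorProduct_apply b c,
      IsGroupLikeBasis.hopfStr_mul_tmul]
    rfl
  · intro g g' h h'
    simp only [IsGroupLikeBasis.hopfBrace, ← Module.Basis.tensorProduct_apply b c,
      IsGroupLikeBasis.hopfStr_mul_tmul]
    rfl

end HopfBraceNL
end
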